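/- arXiv:1805.11988 — 5 statements merged into one kernel-verified Lean document; each statement's English description precedes it below -/
import Mathlib

section
/- If two first-order terms t and u over a language L with variables in a type α are unifiable, then they have a most general unifier: there exists a substitution θ with t.subst θ = u.subst θ such that every unifier ψ of t and u is an instance of θ, i.e. there exists a substitution σ with ψ x = (θ x).subst σ for every variable x : α. -/
open FirstOrder

namespace FirstOrder.Language.Term

variable {L : FirstOrder.Language} {α β γ : Type*}

theorem subst_subst_eq (t : L.Term α) (θ : α → L.Term β) (ψ : β → L.Term γ) :
    (t.subst θ).subst ψ = t.subst fun x => (θ x).subst ψ := by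
  induction t with
  | var => rfl
  | func f ts ih => simp [ih]

/-- The number of symbol occurrences in a term. -/
def symbolCount : L.Term α → ℕ
  | var _ => 1
  | func _ ts => 1 + ∑ i, (ts i).symbolCount

theorem symbolCount_lt_func {l : ℕ} (f : L.Functions l) (ts : Fin l → L.Term α) (i : Fin l) :
    (ts i).symbolCount < (func f ts).symbolCount := by
  have h := Finset.single_le_sum (f := fun j => (ts j).symbolCount)
    (fun _ _ => Nat.zero_le _) (Finset.mem_univ i)
  simp only [symbolCount]
  omega

/-- A term whose instance is smaller than that of `x` does not contain `x`, so it is unchanged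
by replacing `x`. -/
theorem subst_update_var_of_symbolCount_lt [DecidableEq α] {x : α} {θ : α → L.Term β}
    (r : L.Term α) (u : L.Term α) (h : (u.subst θ).symbolCount < (θ x).symbolCount) :
    u.subst (Function.update var x r) = u := by
  induction u with
  | var y =>
    have hy : y ≠ x := by
      rintro rfl
      exact lt_irrefl _ h
    simp [hy]
  | func f us ih =>
    simp only [subst, func.injEq, heq_eq_eq, true_and]
    exact funext fun i =>
      ih i ((symbolCount_lt_func f (fun j => (us j).subst θ) i).trans h)

/-- A unifiable equation between a variable and a term has a most general unifier that is absorbed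
by every unifier. -/
theorem exists_absorbed_unifier_var {θ₀ : α → L.Term β} {x : α} {u : L.Term α}
    (h : θ₀ x = u.subst θ₀) :
    ∃ θ : α → L.Term α, θ x = u.subst θ ∧
      ∀ ψ : α → L.Term α, ψ x = u.subst ψ → ∀ y, (θ y).subst ψ = ψ y := by
  classical
  by_cases hu : u = var x
  · subst hu
    exact ⟨var, rfl, fun _ _ _ => rfl⟩
  have hfix : u.subst (Function.update var x u) = u := by
    cases u with
    | var y =>
      have hy : y ≠ x := fun hy => hu (by rw [hy])
      simp [hy]
    | func f us =>
      simp only [subst, func.injEq, heq_eq_eq, true_and]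
      refine funext fun i => subst_update_var_of_symbolCount_lt (θ := θ₀) _ _ ?_
      rw [h]
      exact symbolCount_lt_func f (fun j => (us j).subst θ₀) i
  refine ⟨Function.update var x u, by rw [hfix, Function.update_self], fun ψ hψ y => ?_⟩
  by_cases hy : y = x
  · subst hy
    rw [Function.update_self, hψ]
  · simp [hy]

/-- Terms with a common instance `w` have a most general unifier that is absorbed by every
unifier. -/
theorem exists_absorbed_unifier (θ₀ : α → L.Term α) (w t u : L.Term α)
    (ht : t.subst θ₀ = w) (hu : u.subst θ₀ = w) :
    ∃ θ : α → L.Term α, t.subst θ = u.subst θ ∧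
      ∀ ψ : α → L.Term α, t.subst ψ = u.subst ψ → ∀ y, (θ y).subst ψ = ψ y := by
  induction w generalizing t u with
  | var a =>
    cases t with
    | var x => exact exists_absorbed_unifier_var (ht.trans hu.symm)
    | func f ts => simp at ht
  | func f ws ih =>
    cases t with
    | var x => exact exists_absorbed_unifier_var (ht.trans hu.symm)
    | func g ts =>
      cases u with
      | var x =>
        obtain ⟨θ, h₁, h₂⟩ := exists_absorbed_unifier_var (x := x) (hu.trans ht.symm)
        exact ⟨θ, h₁.symm, fun ψ hψ => h₂ ψ hψ.symm⟩
      | func g' us =>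
        simp only [subst] at ht hu
        cases ht
        simp only [func.injEq] at hu
        obtain ⟨rfl, hfg, hu⟩ := hu
        obtain rfl := eq_of_heq hfg
        replace hu := eq_of_heq hu
        have key : ∀ s : Finset (Fin _), ∃ θ : α → L.Term α,
            (∀ i ∈ s, (ts i).subst θ = (us i).subst θ) ∧
            ∀ ψ : α → L.Term α, (∀ i ∈ s, (ts i).subst ψ = (us i).subst ψ) →
              ∀ y, (θ y).subst ψ = ψ y := by
          intro s
          induction s using Finset.induction_on with
          | empty => exact ⟨var, by simp, fun _ _ _ => rfl⟩
          | insert a s _ ihs =>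
            obtain ⟨θ₁, h₁, m₁⟩ := ihs
            have absorb (ψ : α → L.Term α)
                (hψ : ∀ i ∈ s, (ts i).subst ψ = (us i).subst ψ) (v : L.Term α) :
                (v.subst θ₁).subst ψ = v.subst ψ := by
              rw [subst_subst_eq, funext (m₁ ψ hψ)]
            have h₀ : ∀ i ∈ s, (ts i).subst θ₀ = (us i).subst θ₀ :=
              fun i _ => (congrFun hu i).symm
            obtain ⟨θ₂, h₂, m₂⟩ := ih a ((ts a).subst θ₁) ((us a).subst θ₁)
              (absorb θ₀ h₀ _) ((absorb θ₀ h₀ _).trans (congrFun hu a))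
            refine ⟨fun x => (θ₁ x).subst θ₂, fun i hi => ?_, fun ψ hψ y => ?_⟩
            · rw [← subst_subst_eq, ← subst_subst_eq]
              rcases Finset.mem_insert.mp hi with rfl | hi
              · exact h₂
              · rw [h₁ i hi]
            · have hs : ∀ i ∈ s, (ts i).subst ψ = (us i).subst ψ :=
                fun i hi => hψ i (Finset.mem_insert_of_mem hi)
              have ha : ((ts a).subst θ₁).subst ψ = ((us a).subst θ₁).subst ψ := by
                rw [absorb ψ hs, absorb ψ hs, hψ a (Finset.mem_insert_self a s)]
              rw [subst_subst_eq, funext (m₂ ψ ha), m₁ ψ hs]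
        obtain ⟨θ, h₁, m⟩ := key Finset.univ
        refine ⟨θ, ?_, fun ψ hψ => m ψ fun i _ => ?_⟩
        · simp only [subst, func.injEq, heq_eq_eq, true_and]
          exact funext fun i => h₁ i (Finset.mem_univ i)
        · simp only [subst, func.injEq, heq_eq_eq, true_and] at hψ
          exact congrFun hψ i

end FirstOrder.Language.Term

theorem mgu_exists {L : FirstOrder.Language} {α : Type*} (t u : L.Term α)
    (h : ∃ θ : α → L.Term α, t.subst θ = u.subst θ) :
    ∃ θ : α → L.Term α, t.subst θ = u.subst θ ∧
      ∀ ψ : α → L.Term α, t.subst ψ = u.subst ψ →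
        ∃ σ : α → L.Term α, ∀ x : α, ψ x = (θ x).subst σ := by
  obtain ⟨θ₀, h₀⟩ := h
  obtain ⟨θ, hθ, m⟩ := Language.Term.exists_absorbed_unifier θ₀ _ t u h₀ rfl
  exact ⟨θ, hθ, fun ψ hψ => ⟨ψ, fun x => (m ψ hψ x).symm⟩⟩
end

section
/- Let α be an infinite type and let t, u be first-order terms over a language L with variables in α. If t is an instance of u and u is an instance of t (there are substitutions σ, σ' with u.subst σ = t and t.subst σ' = u), then t is a renaming of u: there exists a bijection e : α ≃ α such that t = u.relabel e. -/
open FirstOrder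

namespace FirstOrder.Language.Term

variable {L : FirstOrder.Language} {α β γ : Type*}

theorem subst_subst (t : L.Term α) (f : α → L.Term β) (g : β → L.Term γ) :
    (t.subst f).subst g = t.subst fun x => (f x).subst g := by
  induction t with
  | var => rfl
  | func _ _ ih => simp [subst, ih]

theorem subst_var_comp (t : L.Term α) (f : α → β) :
    (t.subst fun x => var (f x)) = t.relabel f := by
  induction t with
  | var => rfl
  | func _ _ ih => simp [subst, ih]

theorem subst_var (t : L.Term α) : t.subst var = t :=
  (t.subst_var_comp id).trans t.relabel_id

theorem subst_eq_subst_iff [DecidableEq α] (t : L.Term α) (f g : α → L.Term β) :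
    t.subst f = t.subst g ↔ ∀ x ∈ t.varFinset, f x = g x := by
  induction t with
  | var => simp [subst]
  | func F ts ih =>
    simp only [subst, func.injEq, heq_eq_eq, true_and, funext_iff, ih, varFinset,
      Finset.mem_biUnion, Finset.mem_univ, forall_exists_index]
    exact forall_comm

theorem exists_eq_var_of_subst_eq_var {t : L.Term α} {f : α → L.Term β} {x : β}
    (h : t.subst f = var x) : ∃ y, t = var y := by
  cases t with
  | var y => exact ⟨y, rfl⟩
  | func => simp [subst] at h

end FirstOrder.Language.Term

open FirstOrder.Language.Term in
theorem mutual_instances_are_renamings {L : FirstOrder.Language} {α : Type*} [Infinite α]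
    (t u : L.Term α) (σ σ' : α → L.Term α)
    (h1 : u.subst σ = t) (h2 : t.subst σ' = u) :
    ∃ e : α ≃ α, t = u.relabel e := by
  classical
  have hinv : ∀ x ∈ u.varFinset, (σ x).subst σ' = var x := by
    rw [← subst_eq_subst_iff, ← subst_subst, h1, h2, subst_var]
  choose f hf using fun x : (u.varFinset : Set α) => exists_eq_var_of_subst_eq_var (hinv x x.2)
  have hinj : Function.Injective f := fun x y hxy => by
    have hx := hinv x x.2
    rw [hf, hxy, ← hf, hinv y y.2] at hx
    exact Subtype.ext (var.inj hx).symm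
  obtain ⟨e, he⟩ := Cardinal.extend_function_of_lt ⟨f, hinj⟩
    ((Cardinal.lt_aleph0_of_finite _).trans_le (Cardinal.aleph0_le_mk α)) ⟨Equiv.refl α⟩
  refine ⟨e, ?_⟩
  rw [← h1, ← subst_var_comp, subst_eq_subst_iff]
  intro x hx
  rw [he ⟨x, hx⟩]
  exact hf ⟨x, hx⟩
end

section
/- Occurs check: let α have decidable equality, let x : α be a variable and t a first-order term over a language L with variables in α such that x ∈ t.varFinset and t ≠ Term.var x. Then there is no substitution θ with θ x = t.subst θ; in particular the variable term Term.var x and t are not unifiable. -/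
open FirstOrder

namespace FirstOrder.Language.Term

/-- The number of occurrences of function symbols in a term. -/
def funcCount {L : FirstOrder.Language} {α : Type*} : L.Term α → ℕ
  | var _ => 0
  | func _ ts => (∑ i, (ts i).funcCount) + 1

theorem funcCount_lt_func {L : FirstOrder.Language} {α : Type*} {l : ℕ} (f : L.Functions l)
    (ts : Fin l → L.Term α) (i : Fin l) : (ts i).funcCount < (func f ts).funcCount :=
  Nat.lt_succ_of_le <|
    Finset.single_le_sum (f := fun i => (ts i).funcCount) (fun _ _ => Nat.zero_le _)
      (Finset.mem_univ i)

theorem funcCount_le_subst {L : FirstOrder.Language} {α β : Type*} [DecidableEq α] {x : α}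
    {t : L.Term α} (hx : x ∈ t.varFinset) (θ : α → L.Term β) :
    (θ x).funcCount ≤ (t.subst θ).funcCount := by
  induction t with
  | var y =>
    obtain rfl : x = y := by simpa using hx
    exact le_rfl
  | func f ts ih =>
    obtain ⟨i, hi⟩ : ∃ i, x ∈ (ts i).varFinset := by simpa using hx
    exact (ih i hi).trans (funcCount_lt_func f (fun i => (ts i).subst θ) i).le

theorem funcCount_lt_subst {L : FirstOrder.Language} {α β : Type*} [DecidableEq α] {x : α}
    {t : L.Term α} (hx : x ∈ t.varFinset) (hne : t ≠ var x) (θ : α → L.Term β) :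
    (θ x).funcCount < (t.subst θ).funcCount := by
  cases t with
  | var y =>
    obtain rfl : x = y := by simpa using hx
    exact absurd rfl hne
  | func f ts =>
    obtain ⟨i, hi⟩ : ∃ i, x ∈ (ts i).varFinset := by simpa using hx
    exact (funcCount_le_subst hi θ).trans_lt (funcCount_lt_func f (fun i => (ts i).subst θ) i)

end FirstOrder.Language.Term

theorem occurs_check {L : FirstOrder.Language} {α : Type*} [DecidableEq α]
    (x : α) (t : L.Term α) (hmem : x ∈ t.varFinset)
    (hne : t ≠ FirstOrder.Language.Term.var x) :
    (¬ ∃ θ : α → L.Term α, θ x = t.subst θ) ∧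
      ¬ ∃ θ : α → L.Term α, (FirstOrder.Language.Term.var x).subst θ = t.subst θ := by
  have h : ¬ ∃ θ : α → L.Term α, θ x = t.subst θ := fun ⟨θ, hθ⟩ =>
    (FirstOrder.Language.Term.funcCount_lt_subst hmem hne θ).ne (congrArg _ hθ)
  exact ⟨h, h⟩
end

section
/- Let α have decidable equality and let t be a first-order term over a language L with variables in α. If σ and σ' are substitutions with (t.subst σ).subst σ' = t, then for every variable x ∈ t.varFinset there is a variable y with σ x = Term.var y, and the induced map x ↦ y is injective on t.varFinset. -/
open FirstOrder

theorem FirstOrder.Language.Term.subst_subst_apply_of_eq_self {L : FirstOrder.Language}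
    {α β : Type*} [DecidableEq α] (σ : α → L.Term β) (σ' : β → L.Term α) (t : L.Term α)
    (h : (t.subst σ).subst σ' = t) :
    ∀ x ∈ t.varFinset, (σ x).subst σ' = FirstOrder.Language.Term.var x := by
  induction t with
  | var a =>
    intro x hx
    obtain rfl : x = a := by simpa using hx
    exact h
  | func F ts ih =>
    intro x hx
    obtain ⟨i, hi⟩ : ∃ i, x ∈ (ts i).varFinset := by simpa using hx
    simp only [FirstOrder.Language.Term.subst, FirstOrder.Language.Term.func.injEq,
      heq_eq_eq, true_and] at h
    exact ih i (congrFun h i) x hi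

theorem FirstOrder.Language.Term.exists_eq_var_of_subst_eq_var_s7 {L : FirstOrder.Language}
    {α β : Type*} {s : L.Term β} {σ : β → L.Term α} {x : α}
    (h : s.subst σ = FirstOrder.Language.Term.var x) :
    ∃ y, s = FirstOrder.Language.Term.var y ∧ σ y = FirstOrder.Language.Term.var x := by
  cases s with
  | var y => exact ⟨y, rfl, h⟩
  | func F ts => simp [FirstOrder.Language.Term.subst] at h

theorem subst_left_invertible_is_renaming {L : FirstOrder.Language} {α : Type*}
    [DecidableEq α] (t : L.Term α) (σ σ' : α → L.Term α)
    (h : (t.subst σ).subst σ' = t) :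
    ∃ f : α → α, (∀ x ∈ t.varFinset, σ x = FirstOrder.Language.Term.var (f x)) ∧
      Set.InjOn f t.varFinset := by
  have key : ∀ x, ∃ y, x ∈ t.varFinset →
      σ x = FirstOrder.Language.Term.var y ∧ σ' y = FirstOrder.Language.Term.var x := by
    intro x
    by_cases hx : x ∈ t.varFinset
    · obtain ⟨y, hy⟩ := FirstOrder.Language.Term.exists_eq_var_of_subst_eq_var_s7
        (FirstOrder.Language.Term.subst_subst_apply_of_eq_self σ σ' t h x hx)
      exact ⟨y, fun _ => hy⟩
    · exact ⟨x, fun hx' => absurd hx' hx⟩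
  choose f hf using key
  refine ⟨f, fun x hx => (hf x hx).1, fun x hx y hy hxy => ?_⟩
  have hxy' := (hf x hx).2
  rw [hxy, (hf y hy).2] at hxy'
  exact (FirstOrder.Language.Term.var.inj hxy').symm
end

section
/- Let α have decidable equality and let u, v be first-order terms over a language L with variables in α such that v.varFinset ⊆ u.varFinset. For any substitutions θ₁, θ₂, if u.subst θ₁ = u.subst θ₂, then v.subst θ₁ = v.subst θ₂. Consequently, the action t ↦ θ u of the flow u ⇐ v on closed terms (where θ unifies v with t) is injective on its domain of definition. -/
open FirstOrder

/-- Two substitutions agree on a term iff they agree on every variable occurring in it. -/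
theorem FirstOrder.Language.Term.subst_eq_subst_iff_s9 {L : FirstOrder.Language} {α β : Type*}
    [DecidableEq α] (t : L.Term α) (θ₁ θ₂ : α → L.Term β) :
    t.subst θ₁ = t.subst θ₂ ↔ ∀ x ∈ t.varFinset, θ₁ x = θ₂ x := by
  induction t with
  | var a => simp [Term.subst]
  | func f ts ih =>
    simp only [Term.subst, Term.func.injEq, heq_eq_eq, true_and, funext_iff, ih, Term.varFinset,
      Finset.mem_biUnion, Finset.mem_univ]
    exact ⟨fun h x ⟨i, hx⟩ => h i x hx, fun h i x hx => h x ⟨i, hx⟩⟩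

theorem flow_action_injective {L : FirstOrder.Language} {α : Type*} [DecidableEq α]
    (u v : L.Term α) (hsub : v.varFinset ⊆ u.varFinset) (θ₁ θ₂ : α → L.Term α)
    (h : u.subst θ₁ = u.subst θ₂) :
    v.subst θ₁ = v.subst θ₂ := by
  rw [FirstOrder.Language.Term.subst_eq_subst_iff_s9] at h ⊢
  exact fun x hx => h x (hsub hx)
end
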